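/- For every λ⊕⊸ proof π, the slicing obtained by evaluating its BDT slicing under all valuations equals its slicing: S_{B(π)} = 𝒮(π), where S_{B(π)} = {v(B(π)) : v a valuation of the variables of π}. -/

import Mathlib

/-- Formulas of the intuitionistic multiplicative-additive calculus λ⊕⊸:
atoms, labeled sums `⊕ₓ`, and linear implication `⊸`. -/
inductive Formula : Type
  | atom : ℕ → Formula
  | oplus : ℕ → Formula → Formula → Formula
  | limp : Formula → Formula → Formula
deriving DecidableEq

namespace Formula

/-- Number of atom occurrences of a formula. -/
def size : Formula → ℕ
  | atom _ => 1
  | oplus _ A B => A.size + B.size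
  | limp A B => A.size + B.size

/-- The list of Boolean-variable labels of the `⊕` occurrences of a formula. -/
def labels : Formula → List ℕ
  | atom _ => []
  | oplus x A B => x :: (A.labels ++ B.labels)
  | limp A B => A.labels ++ B.labels

end Formula

/-- Number of atom occurrences of a context. -/
def csz (Γ : List Formula) : ℕ := (Γ.map Formula.size).sum

/-- All labels of `⊕` occurrences of a sequent `Γ ⊢ C`. -/
def seqLabels (Γ : List Formula) (C : Formula) : List ℕ :=
  (Γ.map Formula.labels).flatten ++ C.labels

/-- Cut-free, η-expanded sequent calculus proofs of λ⊕⊸. -/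
inductive Proof : List Formula → Formula → Type
  | ax (a : ℕ) : Proof [.atom a] (.atom a)
  | limpR {Γ : List Formula} {A B : Formula} :
      Proof (Γ ++ [A]) B → Proof Γ (.limp A B)
  | limpL {Γ Δ : List Formula} {A B C : Formula} :
      Proof Γ A → Proof (B :: Δ) C → Proof (Γ ++ .limp A B :: Δ) C
  | ex (Γ₁ Γ₂ Γ₃ : List Formula) (A B : Formula) {C : Formula} :
      Proof (Γ₁ ++ A :: (Γ₂ ++ B :: Γ₃)) C → Proof (Γ₁ ++ B :: (Γ₂ ++ A :: Γ₃)) C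
  | oplusR1 (x : ℕ) {Γ : List Formula} {A B : Formula} :
      Proof Γ A → Proof Γ (.oplus x A B)
  | oplusR2 (x : ℕ) {Γ : List Formula} {A B : Formula} :
      Proof Γ B → Proof Γ (.oplus x A B)
  | oplusL (x : ℕ) {Γ : List Formula} {A B C : Formula} :
      Proof (Γ ++ [A]) C → Proof (Γ ++ [B]) C → Proof (Γ ++ [.oplus x A B]) C

/-- Atom occurrences of a sequent `Γ ⊢ C` are identified with the positions
`0, 1, 2, …` in the left-to-right flattening of `Γ` followed by `C`.
A slice is a finite set of unordered pairs of such positions. -/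
abbrev Slice := Finset (Sym2 ℕ)

/-- Reindexing the atom occurrences of a slice along a map of positions. -/
def Slice.reindex (f : ℕ → ℕ) (l : Slice) : Slice := l.image (Sym2.map f)

/-- Position reindex for the exchange rule: maps the positions of the layout
`[a-block][p-block][b-block][q-block]rest` to those of `[a-block][q-block][b-block][p-block]rest`. -/
def swapMap (a p b q : ℕ) (i : ℕ) : ℕ :=
  if i < a then i
  else if i < a + p then i + q + b
  else if i < a + p + b then i - p + q
  else if i < a + p + b + q then i - p - b
  else i

/-- The slicing 𝒮(π) of a λ⊕⊸ proof. -/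
def Proof.slicing : {Γ : List Formula} → {C : Formula} → Proof Γ C → Finset Slice
  | _, _, .ax _ => {({s(0, 1)} : Slice)}
  | _, _, .limpR p => p.slicing
  | _, _, @Proof.limpL Γ _ A _ _ p q =>
      Finset.image₂ (fun l m => l ∪ Slice.reindex (fun i => i + (csz Γ + A.size)) m)
        p.slicing q.slicing
  | _, _, @Proof.ex Γ₁ Γ₂ _ A B _ p =>
      p.slicing.image (Slice.reindex (swapMap (csz Γ₁) A.size (csz Γ₂) B.size))
  | _, _, .oplusR1 _ p => p.slicing
  | _, _, @Proof.oplusR2 _ Γ A _ p =>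
      p.slicing.image (Slice.reindex (fun i => if i < csz Γ then i else i + A.size))
  | _, _, @Proof.oplusL _ Γ A B _ p q =>
      p.slicing.image (Slice.reindex (fun i => if i < csz Γ + A.size then i else i + B.size))
      ∪ q.slicing.image (Slice.reindex (fun i => if i < csz Γ then i else i + A.size))

/-- Binary decision trees: leaves labeled `0`/`1` (as `Bool`), inner vertices labeled
by Boolean variables; `node x l r` has left subtree `l` and right subtree `r`. -/
inductive BDT : Type
  | leaf : Bool → BDT
  | node : ℕ → BDT → BDT → BDT
deriving DecidableEq

namespace BDT

/-- Evaluation of a BDT under a valuation: go left when the variable is `false` (0),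
right when it is `true` (1). -/
def eval (v : ℕ → Bool) : BDT → Bool
  | leaf b => b
  | node x l r => if v x then r.eval v else l.eval v

/-- Two BDTs are equivalent when they compute the same Boolean function. -/
def Equiv (φ ψ : BDT) : Prop := ∀ v : ℕ → Bool, φ.eval v = ψ.eval v

/-- Variables occurring in a BDT. -/
def vars : BDT → Finset ℕ
  | leaf _ => ∅
  | node x l r => insert x (l.vars ∪ r.vars)

/-- A BDT is free when no variable occurs twice on a path from the root to a leaf. -/
def Free : BDT → Prop
  | leaf _ => True
  | node x l r => x ∉ l.vars ∧ x ∉ r.vars ∧ l.Free ∧ r.Free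

/-- Negation of a BDT: swap the 0/1 labels at the leaves. -/
def neg : BDT → BDT
  | leaf b => leaf !b
  | node x l r => node x l.neg r.neg

end BDT

/-- The BDT slicing B(π) of a proof, as a function of two atom positions of the
conclusion sequent (it is symmetric in the two positions, and `0` on positions
that do not correspond to a pair of atoms of the sequent). -/
def Proof.bdt : {Γ : List Formula} → {C : Formula} → Proof Γ C → ℕ → ℕ → BDT
  | _, _, .ax _, i, j =>
      if (i = 0 ∧ j = 1) ∨ (i = 1 ∧ j = 0) then .leaf true else .leaf false
  | _, _, .limpR p, i, j => p.bdt i j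
  | _, _, @Proof.limpL Γ _ A _ _ p q, i, j =>
      if i < csz Γ + A.size ∧ j < csz Γ + A.size then p.bdt i j
      else if csz Γ + A.size ≤ i ∧ csz Γ + A.size ≤ j then
        q.bdt (i - (csz Γ + A.size)) (j - (csz Γ + A.size))
      else .leaf false
  | _, _, @Proof.ex Γ₁ Γ₂ _ A B _ p, i, j =>
      p.bdt (swapMap (csz Γ₁) B.size (csz Γ₂) A.size i)
            (swapMap (csz Γ₁) B.size (csz Γ₂) A.size j)
  | _, _, @Proof.oplusR1 _ Γ A _ p, i, j =>
      if i < csz Γ + A.size ∧ j < csz Γ + A.size then p.bdt i j else .leaf false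
  | _, _, @Proof.oplusR2 _ Γ A _ p, i, j =>
      if (i < csz Γ ∨ csz Γ + A.size ≤ i) ∧ (j < csz Γ ∨ csz Γ + A.size ≤ j) then
        p.bdt (if i < csz Γ then i else i - A.size) (if j < csz Γ then j else j - A.size)
      else .leaf false
  | _, _, @Proof.oplusL x Γ A B _ p q, i, j =>
      if ((csz Γ ≤ i ∧ i < csz Γ + A.size) ∧ (csz Γ + A.size ≤ j ∧ j < csz Γ + A.size + B.size)) ∨
         ((csz Γ ≤ j ∧ j < csz Γ + A.size) ∧ (csz Γ + A.size ≤ i ∧ i < csz Γ + A.size + B.size)) then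
        .leaf false
      else if (csz Γ ≤ i ∧ i < csz Γ + A.size) ∨ (csz Γ ≤ j ∧ j < csz Γ + A.size) then
        .node x (p.bdt (if i < csz Γ + A.size then i else i - B.size)
                       (if j < csz Γ + A.size then j else j - B.size)) (.leaf false)
      else if (csz Γ + A.size ≤ i ∧ i < csz Γ + A.size + B.size) ∨
              (csz Γ + A.size ≤ j ∧ j < csz Γ + A.size + B.size) then
        .node x (.leaf false) (q.bdt (if i < csz Γ then i else i - A.size)
                                     (if j < csz Γ then j else j - A.size))
      else
        .node x (p.bdt (if i < csz Γ + A.size then i else i - B.size)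
                       (if j < csz Γ + A.size then j else j - B.size))
                (q.bdt (if i < csz Γ then i else i - A.size)
                       (if j < csz Γ then j else j - A.size))

/-- Smaller element of an unordered pair of positions. -/
def pmin (p : Sym2 ℕ) : ℕ := Sym2.lift ⟨fun a b => min a b, fun a b => min_comm a b⟩ p
/-- Larger element of an unordered pair of positions. -/
def pmax (p : Sym2 ℕ) : ℕ := Sym2.lift ⟨fun a b => max a b, fun a b => max_comm a b⟩ p

/-- The BDT slicing B(π) at an unordered pair of atom positions. -/
def Proof.bdtAt {Γ : List Formula} {C : Formula} (π : Proof Γ C) (p : Sym2 ℕ) : BDT :=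
  π.bdt (pmin p) (pmax p)

/-- The slice obtained by evaluating the BDT slicing of `π` under a valuation `v`:
the set of pairs whose BDT evaluates to `1`. -/
def Proof.vslice {Γ : List Formula} {C : Formula} (π : Proof Γ C) (v : ℕ → Bool) :
    Set (Sym2 ℕ) :=
  {p : Sym2 ℕ | (π.bdtAt p).eval v = true}

/-- The labels of the `⊕†` rules of a proof (its Boolean variables). -/
def Proof.labels : {Γ : List Formula} → {C : Formula} → Proof Γ C → List ℕ
  | _, _, .ax _ => []
  | _, _, .limpR p => p.labels
  | _, _, .limpL p q => p.labels ++ q.labels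
  | _, _, .ex _ _ _ _ _ p => p.labels
  | _, _, .oplusR1 _ p => p.labels
  | _, _, .oplusR2 _ p => p.labels
  | _, _, .oplusL x p q => x :: (p.labels ++ q.labels)

/-- Number of rule occurrences of a proof. -/
def Proof.size : {Γ : List Formula} → {C : Formula} → Proof Γ C → ℕ
  | _, _, .ax _ => 1
  | _, _, .limpR p => p.size + 1
  | _, _, .limpL p q => p.size + q.size + 1
  | _, _, .ex _ _ _ _ _ p => p.size + 1
  | _, _, .oplusR1 _ p => p.size + 1
  | _, _, .oplusR2 _ p => p.size + 1
  | _, _, .oplusL x p q => p.size + q.size + 1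

@[simp] theorem csz_nil : csz [] = 0 := rfl

@[simp] theorem csz_cons (A : Formula) (Γ : List Formula) : csz (A :: Γ) = A.size + csz Γ := by
  simp [csz]

@[simp] theorem csz_append (Γ Δ : List Formula) : csz (Γ ++ Δ) = csz Γ + csz Δ := by
  simp [csz]

theorem Slice.mem_reindex {f g : ℕ → ℕ} (h : ∀ i, g (f i) = i) (l : Slice) (i j : ℕ) :
    s(i, j) ∈ Slice.reindex f l ↔ f (g i) = i ∧ f (g j) = j ∧ s(g i, g j) ∈ l := by
  simp only [Slice.reindex, Finset.mem_image]
  constructor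
  · rintro ⟨⟨a, b⟩, hab, he⟩
    simp only [Sym2.map_mk, Sym2.eq_iff] at he
    rcases he with ⟨rfl, rfl⟩ | ⟨rfl, rfl⟩
    · simpa only [h, true_and] using hab
    · simpa only [h, true_and, Sym2.eq_swap] using hab
  · rintro ⟨hi, hj, hm⟩
    exact ⟨_, hm, by rw [Sym2.map_mk, hi, hj]⟩

theorem swapMap_swapMap (a p b q i : ℕ) : swapMap a q b p (swapMap a p b q i) = i := by
  unfold swapMap
  split_ifs <;> omega

namespace Proof

theorem bdt_symm {Γ : List Formula} {C : Formula} (π : Proof Γ C) (i j : ℕ) :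
    π.bdt i j = π.bdt j i := by
  induction π generalizing i j with
  | ax a => simp only [bdt]; congr 1; exact propext (by tauto)
  | limpR p ih => exact ih i j
  | limpL p q ihp ihq =>
    simp only [bdt, ihp i j, ihq (i - _) (j - _)]
    grind
  | ex Γ₁ Γ₂ Γ₃ A B p ih => exact ih _ _
  | oplusR1 x p ih => simp only [bdt, ih i j]; grind
  | @oplusR2 x Γ A B p ih =>
    simp only [bdt, ih (if i < csz Γ then i else i - A.size)]
    grind
  | @oplusL x Γ A B C p q ihp ihq =>
    simp only [bdt, ihp (if i < csz Γ + A.size then i else i - B.size),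
      ihq (if i < csz Γ then i else i - A.size)]
    grind

theorem eval_bdt_of_le {Γ : List Formula} {C : Formula} (π : Proof Γ C) (v : ℕ → Bool)
    {i : ℕ} (j : ℕ) (hi : csz Γ + C.size ≤ i) : (π.bdt i j).eval v = false := by
  induction π generalizing i j with
  | ax a =>
    simp only [csz_cons, csz_nil, Formula.size] at hi
    simp only [bdt]
    rw [if_neg (by omega)]
    rfl
  | limpR p ih =>
    simp only [csz_append, csz_cons, csz_nil, Formula.size] at hi ih
    exact ih j (by omega)
  | limpL p q ihp ihq =>
    simp only [csz_append, csz_cons, Formula.size] at hi ihq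
    simp only [bdt]
    split_ifs
    · exact ihp j (by omega)
    · exact ihq _ (by omega)
    · rfl
  | ex Γ₁ Γ₂ Γ₃ A B p ih =>
    simp only [csz_append, csz_cons] at hi ih
    refine ih _ ?_
    unfold swapMap
    split_ifs <;> omega
  | oplusR1 x p ih =>
    simp only [Formula.size] at hi
    simp only [bdt]
    split_ifs
    · exact ih j (by omega)
    · rfl
  | oplusR2 x p ih =>
    simp only [Formula.size] at hi
    simp only [bdt]
    rw [apply_ite (BDT.eval v), ih _ (by split_ifs <;> omega)]
    simp [BDT.eval]
  | oplusL x p q ihp ihq =>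
    simp only [csz_append, csz_cons, csz_nil, Formula.size] at hi ihp ihq
    simp only [bdt, apply_ite (BDT.eval v), BDT.eval]
    rw [ihp _ (by split_ifs <;> omega), ihq _ (by split_ifs <;> omega)]
    simp

theorem eval_bdt_congr {Γ : List Formula} {C : Formula} (π : Proof Γ C) {v w : ℕ → Bool}
    (h : ∀ x ∈ seqLabels Γ C, v x = w x) (i j : ℕ) :
    (π.bdt i j).eval v = (π.bdt i j).eval w := by
  induction π generalizing i j with
  | ax a => simp only [bdt]; split_ifs <;> rfl
  | limpR p ih => exact ih (fun x hx => h x (by simp [seqLabels, Formula.labels] at hx ⊢; grind)) i j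
  | limpL p q ihp ihq =>
    have hp := ihp fun x hx => h x (by simp [seqLabels, Formula.labels] at hx ⊢; grind)
    have hq := ihq fun x hx => h x (by simp [seqLabels, Formula.labels] at hx ⊢; grind)
    simp only [bdt, apply_ite (BDT.eval _), hp, hq, BDT.eval]
  | ex Γ₁ Γ₂ Γ₃ A B p ih =>
    exact ih (fun x hx => h x (by simp [seqLabels] at hx ⊢; grind)) _ _
  | oplusR1 x p ih =>
    have hp := ih fun x hx => h x (by simp [seqLabels, Formula.labels] at hx ⊢; grind)
    simp only [bdt, apply_ite (BDT.eval _), hp, BDT.eval]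
  | oplusR2 x p ih =>
    have hp := ih fun x hx => h x (by simp [seqLabels, Formula.labels] at hx ⊢; grind)
    simp only [bdt, apply_ite (BDT.eval _), hp, BDT.eval]
  | oplusL x p q ihp ihq =>
    have hp := ihp fun x hx => h x (by simp [seqLabels, Formula.labels] at hx ⊢; grind)
    have hq := ihq fun x hx => h x (by simp [seqLabels, Formula.labels] at hx ⊢; grind)
    have hx := h x (by simp [seqLabels, Formula.labels])
    simp only [bdt, apply_ite (BDT.eval _), hp, hq, BDT.eval, hx]

/-- The slice `l` consists of the pairs whose BDT evaluates to `1` under `v`. -/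
def IsSliceAt {Γ : List Formula} {C : Formula} (π : Proof Γ C) (v : ℕ → Bool) (l : Slice) : Prop :=
  ∀ i j, s(i, j) ∈ l ↔ (π.bdt i j).eval v = true

theorem IsSliceAt.congr {Γ : List Formula} {C : Formula} {π : Proof Γ C} {v w : ℕ → Bool}
    {l : Slice} (hl : π.IsSliceAt v l) (h : ∀ x ∈ seqLabels Γ C, w x = v x) :
    π.IsSliceAt w l := fun i j => by
  rw [hl, π.eval_bdt_congr h]

theorem isSliceAt_iff {Γ : List Formula} {C : Formula} {π : Proof Γ C} {v : ℕ → Bool}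
    {l : Slice} : π.IsSliceAt v l ↔ π.vslice v = l := by
  have mem : ∀ i j, s(i, j) ∈ π.vslice v ↔ (π.bdt i j).eval v = true := fun i j => by
    change (π.bdt (min i j) (max i j)).eval v = true ↔ _
    rcases le_total i j with h | h
    · rw [min_eq_left h, max_eq_right h]
    · rw [min_eq_right h, max_eq_left h, bdt_symm]
  constructor
  · intro h
    ext ⟨i, j⟩
    exact (mem i j).trans (h i j).symm
  · intro h i j
    rw [← mem, h, Finset.mem_coe]

theorem isSliceAt_ax (a : ℕ) (v : ℕ → Bool) : (ax a).IsSliceAt v {s(0, 1)} := fun i j => by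
  simp only [bdt, Finset.mem_singleton, Sym2.eq_iff]
  split_ifs with h <;> simp [BDT.eval, h]

theorem IsSliceAt.limpL {Γ Δ : List Formula} {A B C : Formula} {p : Proof Γ A}
    {q : Proof (B :: Δ) C} {v : ℕ → Bool} {l m : Slice}
    (hl : p.IsSliceAt v l) (hm : q.IsSliceAt v m) :
    (p.limpL q).IsSliceAt v (l ∪ Slice.reindex (fun i => i + (csz Γ + A.size)) m) := fun i j => by
  rw [Finset.mem_union, hl, Slice.mem_reindex (g := fun i => i - (csz Γ + A.size)) (by simp), hm]
  have hi : csz Γ + A.size ≤ i → _ := p.eval_bdt_of_le v j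
  have hj : csz Γ + A.size ≤ j → _ := p.eval_bdt_of_le v i
  rw [p.bdt_symm] at hj
  simp only [bdt]
  split_ifs with h₁ h₂
  · have : ¬ (i - (csz Γ + A.size) + (csz Γ + A.size) = i) := by omega
    simp [this]
  · simp [hi h₂.1, h₂]
  · have h₃ : ¬ (i - (csz Γ + A.size) + (csz Γ + A.size) = i ∧
        j - (csz Γ + A.size) + (csz Γ + A.size) = j) := by omega
    have h₄ : (p.bdt i j).eval v = false := by
      by_cases h : csz Γ + A.size ≤ i
      · exact hi h
      · exact hj (by omega)
    simp only [h₄, BDT.eval]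
    tauto

theorem IsSliceAt.ex {Γ₁ Γ₂ Γ₃ : List Formula} {A B C : Formula}
    {p : Proof (Γ₁ ++ A :: (Γ₂ ++ B :: Γ₃)) C} {v : ℕ → Bool} {l : Slice}
    (hl : p.IsSliceAt v l) :
    (Proof.ex Γ₁ Γ₂ Γ₃ A B p).IsSliceAt v
      (l.reindex (swapMap (csz Γ₁) A.size (csz Γ₂) B.size)) := fun i j => by
  rw [Slice.mem_reindex (swapMap_swapMap _ _ _ _), hl]
  simp [swapMap_swapMap, bdt]

theorem IsSliceAt.oplusR1 (x : ℕ) {Γ : List Formula} {A B : Formula} {p : Proof Γ A}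
    {v : ℕ → Bool} {l : Slice} (hl : p.IsSliceAt v l) :
    (Proof.oplusR1 (B := B) x p).IsSliceAt v l := fun i j => by
  rw [hl]
  have hi : csz Γ + A.size ≤ i → _ := p.eval_bdt_of_le v j
  have hj : csz Γ + A.size ≤ j → _ := p.eval_bdt_of_le v i
  rw [p.bdt_symm] at hj
  simp only [bdt]
  split_ifs with h
  · rfl
  · have : (p.bdt i j).eval v = false := by
      by_cases h : csz Γ + A.size ≤ i
      · exact hi h
      · exact hj (by omega)
    simp [this, BDT.eval]

theorem IsSliceAt.oplusR2 (x : ℕ) {Γ : List Formula} {A B : Formula} {p : Proof Γ B}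
    {v : ℕ → Bool} {l : Slice} (hl : p.IsSliceAt v l) :
    (Proof.oplusR2 (A := A) x p).IsSliceAt v
      (l.reindex (fun i => if i < csz Γ then i else i + A.size)) := fun i j => by
  rw [Slice.mem_reindex (g := fun i => if i < csz Γ then i else i - A.size)
    (fun i => by grind), hl]
  simp only [bdt, apply_ite (BDT.eval v), BDT.eval]
  grind

theorem IsSliceAt.oplusL_left {x : ℕ} {Γ : List Formula} {A B C : Formula}
    {p : Proof (Γ ++ [A]) C} (q : Proof (Γ ++ [B]) C) {v : ℕ → Bool} {l : Slice}
    (hv : v x = false) (hl : p.IsSliceAt v l) :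
    (Proof.oplusL x p q).IsSliceAt v
      (l.reindex (fun i => if i < csz Γ + A.size then i else i + B.size)) := fun i j => by
  rw [Slice.mem_reindex (g := fun i => if i < csz Γ + A.size then i else i - B.size)
    (fun i => by grind), hl]
  have hrange : ∀ k, (if (if k < csz Γ + A.size then k else k - B.size) < csz Γ + A.size
      then (if k < csz Γ + A.size then k else k - B.size)
      else (if k < csz Γ + A.size then k else k - B.size) + B.size) = k ↔
      ¬ (csz Γ + A.size ≤ k ∧ k < csz Γ + A.size + B.size) := fun k => by
    split_ifs <;> omega
  simp only [hrange, bdt, apply_ite (BDT.eval v), BDT.eval, hv]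
  generalize (p.bdt _ _).eval v = b
  grind

theorem IsSliceAt.oplusL_right {x : ℕ} {Γ : List Formula} {A B C : Formula}
    (p : Proof (Γ ++ [A]) C) {q : Proof (Γ ++ [B]) C} {v : ℕ → Bool} {l : Slice}
    (hv : v x = true) (hl : q.IsSliceAt v l) :
    (Proof.oplusL x p q).IsSliceAt v
      (l.reindex (fun i => if i < csz Γ then i else i + A.size)) := fun i j => by
  rw [Slice.mem_reindex (g := fun i => if i < csz Γ then i else i - A.size)
    (fun i => by grind), hl]
  have hrange : ∀ k, (if (if k < csz Γ then k else k - A.size) < csz Γ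
      then (if k < csz Γ then k else k - A.size)
      else (if k < csz Γ then k else k - A.size) + A.size) = k ↔
      ¬ (csz Γ ≤ k ∧ k < csz Γ + A.size) := fun k => by
    split_ifs <;> omega
  simp only [hrange, bdt, apply_ite (BDT.eval v), BDT.eval, hv]
  generalize (q.bdt _ _).eval v = b
  grind

theorem exists_mem_slicing_isSliceAt {Γ : List Formula} {C : Formula} (π : Proof Γ C)
    (v : ℕ → Bool) : ∃ l ∈ π.slicing, π.IsSliceAt v l := by
  induction π with
  | ax a => exact ⟨_, Finset.mem_singleton_self _, isSliceAt_ax a v⟩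
  | limpR p ih => exact ih
  | limpL p q ihp ihq =>
    obtain ⟨l, hl, hl'⟩ := ihp
    obtain ⟨m, hm, hm'⟩ := ihq
    exact ⟨_, Finset.mem_image₂_of_mem hl hm, hl'.limpL hm'⟩
  | ex Γ₁ Γ₂ Γ₃ A B p ih =>
    obtain ⟨l, hl, hl'⟩ := ih
    exact ⟨_, Finset.mem_image_of_mem _ hl, hl'.ex⟩
  | oplusR1 x p ih =>
    obtain ⟨l, hl, hl'⟩ := ih
    exact ⟨l, hl, hl'.oplusR1 x⟩
  | oplusR2 x p ih =>
    obtain ⟨l, hl, hl'⟩ := ih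
    exact ⟨_, Finset.mem_image_of_mem _ hl, hl'.oplusR2 x⟩
  | oplusL x p q ihp ihq =>
    cases hv : v x with
    | false =>
      obtain ⟨l, hl, hl'⟩ := ihp
      exact ⟨_, Finset.mem_union_left _ (Finset.mem_image_of_mem _ hl), hl'.oplusL_left q hv⟩
    | true =>
      obtain ⟨l, hl, hl'⟩ := ihq
      exact ⟨_, Finset.mem_union_right _ (Finset.mem_image_of_mem _ hl), hl'.oplusL_right p hv⟩

theorem exists_isSliceAt_of_mem_slicing {Γ : List Formula} {C : Formula} (π : Proof Γ C)
    (hlab : (seqLabels Γ C).Nodup) {l : Slice} (hl : l ∈ π.slicing) :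
    ∃ v, π.IsSliceAt v l := by
  induction π generalizing l with
  | ax a =>
    rw [slicing, Finset.mem_singleton] at hl
    exact ⟨fun _ => false, hl ▸ isSliceAt_ax a _⟩
  | limpR p ih => exact ih (by simpa [seqLabels, Formula.labels] using hlab) hl
  | @limpL Γ Δ A B C p q ihp ihq =>
    rw [slicing, Finset.mem_image₂] at hl
    obtain ⟨l, hl, m, hm, rfl⟩ := hl
    have hperm : (seqLabels (Γ ++ Formula.limp A B :: Δ) C).Perm
        (seqLabels Γ A ++ seqLabels (B :: Δ) C) := by
      simp [seqLabels, Formula.labels]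
    obtain ⟨hA, hB, hdisj⟩ := List.nodup_append'.1 (hperm.nodup_iff.1 hlab)
    obtain ⟨v, hv⟩ := ihp hA hl
    obtain ⟨w, hw⟩ := ihq hB hm
    refine ⟨fun x => if x ∈ seqLabels Γ A then v x else w x,
      (hv.congr fun x hx => if_pos hx).limpL (hw.congr fun x hx => if_neg fun h => hdisj h hx)⟩
  | ex Γ₁ Γ₂ Γ₃ A B p ih =>
    rw [slicing, Finset.mem_image] at hl
    obtain ⟨l, hl, rfl⟩ := hl
    have hctx : (Γ₁ ++ A :: (Γ₂ ++ B :: Γ₃)).Perm (Γ₁ ++ B :: (Γ₂ ++ A :: Γ₃)) := by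
      refine List.Perm.append_left _ ?_
      refine (List.perm_middle.cons A).trans ?_
      exact (List.Perm.swap B A _).trans (List.perm_middle.symm.cons B)
    have hperm := ((hctx.map Formula.labels).flatten).append_right (Formula.labels ‹_›)
    obtain ⟨v, hv⟩ := ih (hperm.nodup_iff.2 hlab) hl
    exact ⟨v, hv.ex⟩
  | oplusR1 x p ih =>
    refine (ih (hlab.sublist ?_) hl).imp fun v hv => hv.oplusR1 x
    simp [seqLabels, Formula.labels]
  | oplusR2 x p ih =>
    rw [slicing, Finset.mem_image] at hl
    obtain ⟨l, hl, rfl⟩ := hl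
    refine (ih (hlab.sublist ?_) hl).imp fun v hv => hv.oplusR2 x
    simp [seqLabels, Formula.labels]
  | @oplusL x Γ A B C p q ihp ihq =>
    have hperm : (seqLabels (Γ ++ [Formula.oplus x A B]) C).Perm
        (x :: ((Γ.map Formula.labels).flatten ++ (A.labels ++ (B.labels ++ C.labels)))) := by
      simp [seqLabels, Formula.labels]
    obtain ⟨hx, hnd⟩ := List.nodup_cons.1 (hperm.nodup_iff.1 hlab)
    have hsA : (seqLabels (Γ ++ [A]) C).Sublist
        ((Γ.map Formula.labels).flatten ++ (A.labels ++ (B.labels ++ C.labels))) := by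
      simp [seqLabels]
    have hsB : (seqLabels (Γ ++ [B]) C).Sublist
        ((Γ.map Formula.labels).flatten ++ (A.labels ++ (B.labels ++ C.labels))) := by
      simp [seqLabels]
    rw [slicing, Finset.mem_union, Finset.mem_image, Finset.mem_image] at hl
    rcases hl with ⟨l, hl, rfl⟩ | ⟨l, hl, rfl⟩
    · obtain ⟨v, hv⟩ := ihp (hnd.sublist hsA) hl
      refine ⟨Function.update v x false, IsSliceAt.oplusL_left q (by simp) (hv.congr ?_)⟩
      exact fun y hy => Function.update_of_ne (fun h : y = x => hx (h ▸ hsA.subset hy)) _ _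
    · obtain ⟨v, hv⟩ := ihq (hnd.sublist hsB) hl
      refine ⟨Function.update v x true, IsSliceAt.oplusL_right p (by simp) (hv.congr ?_)⟩
      exact fun y hy => Function.update_of_ne (fun h : y = x => hx (h ▸ hsB.subset hy)) _ _

end Proof

/-- For every λ⊕⊸ proof `π` (of a sequent with distinct `⊕` labels), the slicing obtained
by evaluating its BDT slicing under all valuations equals its slicing:
`S_{B(π)} = {v(B(π)) : v a valuation} = 𝒮(π)`. -/
theorem vslices_eq_slicing
    (Γ : List Formula) (C : Formula) (hlab : (seqLabels Γ C).Nodup)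
    (π : Proof Γ C) :
    {s : Set (Sym2 ℕ) | ∃ v : ℕ → Bool, s = π.vslice v} =
      {s : Set (Sym2 ℕ) | ∃ l ∈ π.slicing, s = (l : Set (Sym2 ℕ))} := by
  ext s
  constructor
  · rintro ⟨v, rfl⟩
    obtain ⟨l, hl, hv⟩ := π.exists_mem_slicing_isSliceAt v
    exact ⟨l, hl, Proof.isSliceAt_iff.1 hv⟩
  · rintro ⟨l, hl, rfl⟩
    obtain ⟨v, hv⟩ := π.exists_isSliceAt_of_mem_slicing hlab hl
    exact ⟨v, (Proof.isSliceAt_iff.1 hv).symm⟩
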